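/- arXiv:1702.01753 — 2 statements merged into one kernel-verified Lean document; each statement's English description precedes it below -/
import Mathlib

section
/- Central reduction for a single constraint: Let s ∈ Sym TT_n, let O ⊆ TT_n be the subring consisting of all polynomials with rational coefficients in s and the scalar matrices tr(s^i)·I for i ∈ ℕ, and let S = {tr(hsh)·I : h ∈ O} ⊆ C_n. Then there exists a finite subset S₀ ⊆ S such that K_{{s}} = K_{S₀}. -/
noncomputable section

open Matrix

/-- The polynomial ring ℝ[ξ] in the g·n² commuting variables ξ_{jıȷ}. -/
abbrev PolyRing (n g : ℕ) : Type := MvPolynomial (Fin g × Fin n × Fin n) ℝ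

/-- n×n matrices over ℝ[ξ]. -/
abbrev MatP (n g : ℕ) : Type := Matrix (Fin n) (Fin n) (PolyRing n g)

/-- The generic matrices Ξ_j = (ξ_{jıȷ})_{ıȷ}. -/
def genMat (n g : ℕ) (j : Fin g) : MatP n g :=
  Matrix.of fun a b => MvPolynomial.X (j, a, b)

/-- The set of generic matrices together with their transposes. -/
def genSet (n g : ℕ) : Set (MatP n g) :=
  Set.range (genMat n g) ∪ Set.range (fun j => (genMat n g j)ᵀ)

/-- The trace ring TT_n: the ℝ-subalgebra of M_n(ℝ[ξ]) generated by the Ξ_j, their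
transposes, and the scalar matrices tr(w)·1 for all products w of the Ξ_j, Ξ_jᵀ. -/
def traceRing (n g : ℕ) : Subalgebra ℝ (MatP n g) :=
  Algebra.adjoin ℝ
    (genSet n g ∪
      {m | ∃ w ∈ Submonoid.closure (genSet n g), m = (Matrix.trace w) • (1 : MatP n g)})

/-- The center C_n of the trace ring: the scalar matrices in TT_n. -/
def centerSet (n g : ℕ) : Set (MatP n g) :=
  {c | c ∈ traceRing n g ∧ ∃ p : PolyRing n g, c = p • (1 : MatP n g)}

/-- Evaluation of a matrix of polynomials at a g-tuple X of n×n real matrices. -/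
def evalMat (n g : ℕ) (X : Fin g → Matrix (Fin n) (Fin n) ℝ) (h : MatP n g) :
    Matrix (Fin n) (Fin n) ℝ :=
  h.map (MvPolynomial.eval fun v => X v.1 v.2.1 v.2.2)

/-- The semialgebraic set K_S determined by S. -/
def KSet (n g : ℕ) (S : Set (MatP n g)) : Set (Fin g → Matrix (Fin n) (Fin n) ℝ) :=
  {X | ∀ s ∈ S, (evalMat n g X s).PosSemidef}

/-- Cyclic quadratic module in Sym TT_n. -/
def IsCyclicQM (n g : ℕ) (Q : Set (MatP n g)) : Prop :=
  (∀ q ∈ Q, q ∈ traceRing n g ∧ qᵀ = q) ∧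
  (1 : MatP n g) ∈ Q ∧
  (∀ a ∈ Q, ∀ b ∈ Q, a + b ∈ Q) ∧
  (∀ h ∈ traceRing n g, ∀ q ∈ Q, h * q * hᵀ ∈ Q) ∧
  (∀ q ∈ Q, (Matrix.trace q) • (1 : MatP n g) ∈ Q)

/-- Cyclic preordering: a cyclic quadratic module whose intersection with the center
is closed under multiplication. -/
def IsCyclicPreordering (n g : ℕ) (T : Set (MatP n g)) : Prop :=
  IsCyclicQM n g T ∧
  ∀ a ∈ T ∩ centerSet n g, ∀ b ∈ T ∩ centerSet n g, a * b ∈ T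

/-- The smallest cyclic preordering T_S^tr containing S. -/
def TtrS (n g : ℕ) (S : Set (MatP n g)) : Set (MatP n g) :=
  {a | ∀ T : Set (MatP n g), IsCyclicPreordering n g T → S ⊆ T → a ∈ T}

/-- The quadratic form `∑ cᵢ cⱼ Mᵢⱼ`. -/
def quadForm {R : Type*} [CommRing R] {m : ℕ} (M : Fin m → Fin m → R) (c : Fin m → R) : R :=
  ∑ i, ∑ j, c i * c j * M i j

lemma map_quadForm {R R' : Type*} [CommRing R] [CommRing R'] (φ : R →+* R') {m : ℕ}
    (M : Fin m → Fin m → R) (c : Fin m → R) :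
    φ (quadForm M c) = quadForm (fun i j => φ (M i j)) (fun i => φ (c i)) := by
  simp [quadForm]

lemma quadForm_cons {R : Type*} [CommRing R] {m : ℕ} (M : Fin (m + 1) → Fin (m + 1) → R)
    (hM : ∀ i j, M i j = M j i) (a : R) (w : Fin m → R) :
    quadForm M (Fin.cons a w) = a ^ 2 * M 0 0 + 2 * a * (∑ j, w j * M 0 j.succ) +
      quadForm (fun i j => M i.succ j.succ) w := by
  have h : ∑ i, w i * a * M i.succ 0 = a * ∑ j, w j * M 0 j.succ := by
    rw [Finset.mul_sum]
    exact Finset.sum_congr rfl fun i _ => by rw [hM i.succ 0]; ring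
  have h' : ∑ j, a * w j * M 0 j.succ = a * ∑ j, w j * M 0 j.succ := by
    rw [Finset.mul_sum]
    exact Finset.sum_congr rfl fun i _ => by ring
  simp only [quadForm, Fin.sum_univ_succ, Fin.cons_zero, Fin.cons_succ, Finset.sum_add_distrib,
    h, h']
  ring

lemma quadForm_schur {R : Type*} [CommRing R] {m : ℕ} (a : R) (b : Fin m → R)
    (M : Fin m → Fin m → R) (w : Fin m → R) :
    quadForm (fun i j => a * M i j - b i * b j) w =
      a * quadForm M w - (∑ j, w j * b j) ^ 2 := by
  rw [pow_two, Finset.sum_mul_sum]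
  simp only [quadForm, Finset.mul_sum, ← Finset.sum_sub_distrib]
  exact Finset.sum_congr rfl fun i _ => Finset.sum_congr rfl fun j _ => by ring

lemma quadForm_smul {R : Type*} [CommRing R] {m : ℕ} (a : R)
    (M : Fin m → Fin m → R) (w : Fin m → R) :
    quadForm M (fun i => a * w i) = a ^ 2 * quadForm M w := by
  simp only [quadForm, Finset.mul_sum]
  exact Finset.sum_congr rfl fun i _ => Finset.sum_congr rfl fun j _ => by ring

lemma quadForm_single {R : Type*} [CommRing R] {m : ℕ} (M : Fin m → Fin m → R) (j : Fin m)
    (b : R) : quadForm M (Pi.single j b) = b ^ 2 * M j j := by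
  rw [quadForm, Finset.sum_eq_single j, Finset.sum_eq_single j]
  · simp; ring
  · intro i _ hi; simp [hi]
  · simp
  · intro i _ hi; simp [hi]
  · simp

/-- Positive semidefiniteness of all real specializations of a symmetric matrix over a commutative
ring can be tested on finitely many vectors over that ring. -/
lemma exists_finite_quadForm_test {R : Type*} [CommRing R] (m : ℕ) (M : Fin m → Fin m → R)
    (hM : ∀ i j, M i j = M j i) :
    ∃ F : Set (Fin m → R), F.Finite ∧ ∀ φ : R →+* ℝ, (∀ c ∈ F, 0 ≤ φ (quadForm M c)) →
      ∀ x : Fin m → ℝ, 0 ≤ quadForm (fun i j => φ (M i j)) x := by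
  induction m with
  | zero => exact ⟨∅, Set.finite_empty, fun φ _ x => by simp [quadForm]⟩
  | succ m ih =>
    obtain ⟨F₁, hF₁, H₁⟩ := ih
      (fun i j => M 0 0 * M i.succ j.succ - M 0 i.succ * M 0 j.succ)
      (fun i j => by rw [hM i.succ j.succ]; ring)
    obtain ⟨F₂, hF₂, H₂⟩ := ih (fun i j => M i.succ j.succ) (fun i j => hM _ _)
    let schurLift : (Fin m → R) → Fin (m + 1) → R := fun w =>
      Fin.cons (-∑ j, w j * M 0 j.succ) (fun i => M 0 0 * w i)
    let zeroLift : (Fin m → R) → Fin (m + 1) → R := fun w => Fin.cons 0 w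
    let crossVec : Fin m → Fin (m + 1) → R := fun j =>
      Fin.cons (-(M j.succ j.succ + 1)) (Pi.single j (M 0 j.succ))
    refine ⟨{Pi.single 0 1} ∪ schurLift '' F₁ ∪ zeroLift '' F₂ ∪ Set.range crossVec ∪
        Set.range (fun j => Pi.single j 1),
      ((((Set.finite_singleton _).union (hF₁.image _)).union (hF₂.image _)).union
        (Set.finite_range _)).union (Set.finite_range _), fun φ hφ x => ?_⟩
    have hdiag : ∀ j, 0 ≤ φ (M j j) := fun j => by
      have := hφ (Pi.single j 1) (Or.inr ⟨j, rfl⟩)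
      simpa [quadForm_single] using this
    obtain ⟨t, y, rfl⟩ : ∃ t y, x = Fin.cons t y := ⟨x 0, Fin.tail x, (Fin.cons_self_tail x).symm⟩
    rw [quadForm_cons _ (fun i j => by rw [hM])]
    rcases (hdiag 0).eq_or_lt with h0 | hpos
    · have hb : ∀ j : Fin m, φ (M 0 j.succ) = 0 := fun j => by
        have h := hφ (crossVec j) (Or.inl (Or.inr ⟨j, rfl⟩))
        have hs : ∑ k, (Pi.single j (M 0 j.succ) : Fin m → R) k * M 0 k.succ
            = M 0 j.succ ^ 2 := by
          rw [Finset.sum_eq_single j] <;> simp +contextual [pow_two]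
        rw [quadForm_cons M hM, hs, quadForm_single] at h
        simp only [map_add, map_mul, map_pow, map_neg, map_one, map_ofNat, ← h0] at h
        have hd := hdiag j.succ
        by_contra hne
        have hsq := pow_pos (abs_pos.mpr hne) 2
        rw [sq_abs] at hsq
        nlinarith [mul_nonneg hsq.le hd]
      have h2 := H₂ φ (fun c hc => by
        have h := hφ (zeroLift c) (Or.inl (Or.inl (Or.inr ⟨c, hc, rfl⟩)))
        rw [quadForm_cons M hM] at h
        simpa using h) y
      simpa [← h0, hb] using h2
    · have h1 := H₁ φ (fun c hc => by
        have h := hφ (schurLift c) (Or.inl (Or.inl (Or.inl (Or.inr ⟨c, hc, rfl⟩))))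
        have hs : ∑ j, M 0 0 * c j * M 0 j.succ = M 0 0 * ∑ j, c j * M 0 j.succ := by
          simp only [Finset.mul_sum, mul_assoc]
        rw [quadForm_cons M hM, quadForm_smul, hs] at h
        refine nonneg_of_mul_nonneg_right (a := φ (M 0 0)) ?_ hpos
        rw [quadForm_schur, ← map_mul]
        refine h.trans_eq (congrArg φ ?_)
        ring) y
      simp only [map_sub, map_mul] at h1
      rw [quadForm_schur] at h1
      refine nonneg_of_mul_nonneg_right (a := φ (M 0 0)) ?_ hpos
      nlinarith [sq_nonneg (φ (M 0 0) * t + ∑ j, y j * φ (M 0 j.succ))]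

lemma trace_pow_sum_mul_mul {R : Type*} [CommRing R] {n m : ℕ} (A : Matrix (Fin n) (Fin n) R)
    (c : Fin m → R) :
    trace ((∑ i, c i • A ^ (i : ℕ)) * A * ∑ i, c i • A ^ (i : ℕ)) =
      quadForm (fun i j : Fin m => trace (A ^ ((i : ℕ) + j + 1))) c := by
  simp only [quadForm, Finset.sum_mul, Finset.mul_sum, trace_sum]
  rw [Finset.sum_comm]
  refine Finset.sum_congr rfl fun i _ => Finset.sum_congr rfl fun j _ => ?_
  simp only [smul_mul_assoc, mul_smul_comm, smul_smul, trace_smul, smul_eq_mul]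
  rw [← pow_succ, ← pow_add, add_right_comm]
  ring

open Polynomial in
lemma Matrix.IsHermitian.trace_aeval {n : ℕ} {A : Matrix (Fin n) (Fin n) ℝ} (hA : A.IsHermitian)
    (p : ℝ[X]) : trace (aeval A p) = ∑ i, p.eval (hA.eigenvalues i) := by
  have hdiag : aeval (diagonal hA.eigenvalues) p
      = diagonal fun i => p.eval (hA.eigenvalues i) := by
    have := aeval_algHom_apply (diagonalAlgHom ℝ : (Fin n → ℝ) →ₐ[ℝ] _) hA.eigenvalues p
    simp only [diagonalAlgHom_apply] at this
    rw [this]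
    congr 1
    ext i
    simp
  have hspec := hA.spectral_theorem
  have h2 : aeval A p = Unitary.conjStarAlgAut ℝ _ hA.eigenvectorUnitary
      (aeval (diagonal hA.eigenvalues) p) := by
    have := aeval_algHom_apply
      ((Unitary.conjStarAlgAut ℝ (Matrix (Fin n) (Fin n) ℝ)
        hA.eigenvectorUnitary).toAlgEquiv.toAlgHom) (diagonal hA.eigenvalues) p
    conv_lhs => rw [hspec]
    exact this
  rw [h2, hdiag, Unitary.conjStarAlgAut_apply, trace_mul_cycle, Unitary.coe_star_mul_self, one_mul,
    trace_diagonal]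

open Polynomial in
lemma posSemidef_of_quadForm_trace_pow_nonneg {n : ℕ} {A : Matrix (Fin n) (Fin n) ℝ}
    (hA : A.IsHermitian)
    (h : ∀ x, 0 ≤ quadForm (fun i j : Fin n => trace (A ^ ((i : ℕ) + j + 1))) x) :
    A.PosSemidef := by
  rw [hA.posSemidef_iff_eigenvalues_nonneg]
  intro k
  by_contra hk
  simp only [Pi.zero_apply, not_le] at hk
  let E : Finset ℝ := Finset.univ.image hA.eigenvalues
  have hmem : ∀ i, hA.eigenvalues i ∈ E := fun i => Finset.mem_image_of_mem _ (Finset.mem_univ i)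
  let p : ℝ[X] := Lagrange.basis E id (hA.eigenvalues k)
  have hp1 : p.eval (hA.eigenvalues k) = 1 :=
    Lagrange.eval_basis_self (v := id) (Set.injOn_id _) (hmem k)
  have hp0 : ∀ i, hA.eigenvalues i ≠ hA.eigenvalues k → p.eval (hA.eigenvalues i) = 0 :=
    fun i hi => Lagrange.eval_basis_of_ne (v := id) hi.symm (hmem i)
  have hdeg : p.natDegree < n := by
    have h1 : p.natDegree = E.card - 1 :=
      Lagrange.natDegree_basis (Set.injOn_id _) (hmem k)
    have h2 : E.card ≤ n := Finset.card_image_le.trans (by simp)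
    have h3 : 0 < E.card := Finset.card_pos.mpr ⟨_, hmem k⟩
    omega
  have hsum : ∑ i : Fin n, p.coeff i • A ^ (i : ℕ) = aeval A p := by
    rw [aeval_eq_sum_range' hdeg, Finset.sum_range]
  have h1 := h (fun i => p.coeff i)
  rw [← trace_pow_sum_mul_mul, hsum] at h1
  have h2 : aeval A p * A * aeval A p = aeval A (p * X * p) := by simp
  rw [h2, hA.trace_aeval] at h1
  refine absurd h1 (not_le.mpr (Finset.sum_neg' (fun i _ => ?_) ⟨k, Finset.mem_univ k, ?_⟩))
  · by_cases hi : hA.eigenvalues i = hA.eigenvalues k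
    · simp [hi, hp1, hk.le]
    · simp [hp0 i hi]
  · simpa [hp1] using hk

lemma posSemidef_smul_one_iff {n : ℕ} (hn : 0 < n) (a : ℝ) :
    (a • (1 : Matrix (Fin n) (Fin n) ℝ)).PosSemidef ↔ 0 ≤ a := by
  refine ⟨fun h => ?_, fun h => PosSemidef.one.smul h⟩
  simpa using h.diag_nonneg (i := ⟨0, hn⟩)

/-- Positivity of `∑ cᵢ cⱼ tr(A^(i+j+1))` for a positive semidefinite matrix `A`. -/
lemma quadForm_trace_pow_nonneg {n m : ℕ} {A : Matrix (Fin n) (Fin n) ℝ} (hA : A.PosSemidef)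
    (c : Fin m → ℝ) :
    0 ≤ quadForm (fun i j : Fin m => trace (A ^ ((i : ℕ) + j + 1))) c := by
  rw [← trace_pow_sum_mul_mul]
  have hP : (∑ i, c i • A ^ (i : ℕ))ᴴ = ∑ i, c i • A ^ (i : ℕ) := by
    rw [conjTranspose_sum]
    exact Finset.sum_congr rfl fun i _ => by
      rw [conjTranspose_smul, conjTranspose_pow, hA.isHermitian.eq, star_trivial]
  have := (hA.mul_mul_conjTranspose_same (∑ i, c i • A ^ (i : ℕ))).trace_nonneg
  rwa [hP] at this

/-- Central reduction for a single constraint. -/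
theorem stmt9 (n g : ℕ) (hn : 0 < n) (hg : 0 < g)
    (s : MatP n g) (hsT : s ∈ traceRing n g) (hsSym : sᵀ = s) :
    ∃ S₀ : Set (MatP n g),
      S₀ ⊆ {c : MatP n g | ∃ h ∈ Algebra.adjoin ℚ
              ({s} ∪ {c' : MatP n g | ∃ i : ℕ,
                c' = (Matrix.trace (s ^ i)) • (1 : MatP n g)}),
            c = (Matrix.trace (h * s * h)) • (1 : MatP n g)} ∧
      S₀.Finite ∧ KSet n g {s} = KSet n g S₀ := by
  let R : Subalgebra ℚ (PolyRing n g) :=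
    Algebra.adjoin ℚ (Set.range fun i : ℕ => trace (s ^ i))
  let M : Fin n → Fin n → R := fun i j =>
    ⟨trace (s ^ ((i : ℕ) + j + 1)), Algebra.subset_adjoin ⟨_, rfl⟩⟩
  obtain ⟨F, hF, hPSD⟩ := exists_finite_quadForm_test n M
    (fun i j => Subtype.ext (by simp only [M, add_comm (i : ℕ) j]))
  let P : (Fin n → R) → MatP n g := fun c => ∑ i, (c i : PolyRing n g) • s ^ (i : ℕ)
  have htr : ∀ c, trace (P c * s * P c) = (quadForm M c : R) := fun c => by
    have h := map_quadForm R.val.toRingHom M c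
    exact (trace_pow_sum_mul_mul s _).trans h.symm
  have heval : ∀ X (c : Fin n → R), evalMat n g X (trace (P c * s * P c) • (1 : MatP n g)) =
      MvPolynomial.eval (fun v : Fin g × Fin n × Fin n => X v.1 v.2.1 v.2.2)
        (quadForm M c : R) •
        (1 : Matrix (Fin n) (Fin n) ℝ) := fun X c => by
    rw [htr]
    ext i j
    by_cases hij : i = j <;> simp [evalMat, hij]
  have htrace : ∀ X k, MvPolynomial.eval (fun v => X v.1 v.2.1 v.2.2) (trace (s ^ k)) =
      trace (evalMat n g X s ^ k) := fun X k => by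
    have h := map_pow (RingHom.mapMatrix (m := Fin n)
      (MvPolynomial.eval fun v : Fin g × Fin n × Fin n => X v.1 v.2.1 v.2.2)) s k
    change _ = trace ((RingHom.mapMatrix _ s) ^ k)
    rw [← h, RingHom.mapMatrix_apply]
    simp [trace]
  let φ : (Fin g → Matrix (Fin n) (Fin n) ℝ) → R →+* ℝ := fun X =>
    (MvPolynomial.eval fun v => X v.1 v.2.1 v.2.2).comp R.val.toRingHom
  have hM : ∀ X, (fun i j => φ X (M i j)) =
      fun i j : Fin n => trace (evalMat n g X s ^ ((i : ℕ) + j + 1)) := fun X => by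
    ext i j
    exact htrace X _
  refine ⟨(fun c => trace (P c * s * P c) • (1 : MatP n g)) '' F, ?_, hF.image _, ?_⟩
  · rintro _ ⟨c, -, rfl⟩
    refine ⟨P c, Subalgebra.sum_mem _ fun i _ => ?_, rfl⟩
    have hsc : ∀ r ∈ R, r • (1 : MatP n g) ∈ Algebra.adjoin ℚ
        ({s} ∪ {c' : MatP n g | ∃ i : ℕ, c' = trace (s ^ i) • (1 : MatP n g)}) := fun r hr => by
      induction hr using Algebra.adjoin_induction with
      | mem x hx =>
        obtain ⟨i, rfl⟩ := hx
        exact Algebra.subset_adjoin (Or.inr ⟨i, rfl⟩)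
      | algebraMap q =>
        rw [algebraMap_smul, ← Algebra.algebraMap_eq_smul_one]
        exact Subalgebra.algebraMap_mem _ q
      | add x y _ _ hx hy => rw [add_smul]; exact add_mem hx hy
      | mul x y _ _ hx hy =>
        have : (x * y) • (1 : MatP n g) = x • 1 * y • 1 := by
          rw [smul_mul_smul_comm, one_mul]
        rw [this]
        exact mul_mem hx hy
    rw [← one_mul (s ^ (i : ℕ)), ← smul_mul_assoc]
    have hs : s ∈ Algebra.adjoin ℚ
        ({s} ∪ {c' : MatP n g | ∃ i : ℕ, c' = trace (s ^ i) • (1 : MatP n g)}) :=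
      Algebra.subset_adjoin (Or.inl rfl)
    exact mul_mem (hsc _ (c i).2) (pow_mem hs _)
  · ext X
    simp only [KSet, Set.mem_ofPred_eq, Set.mem_singleton_iff, forall_eq, Set.forall_mem_image,
      heval, posSemidef_smul_one_iff hn]
    constructor
    · intro h c _
      change 0 ≤ φ X (quadForm M c)
      rw [map_quadForm, hM]
      exact quadForm_trace_pow_nonneg h _
    · intro h
      refine posSemidef_of_quadForm_trace_pow_nonneg ?_ fun x => ?_
      · ext i j
        simp only [conjTranspose_apply, evalMat, map_apply, star_trivial]
        rw [← transpose_apply s, hsSym]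
      · rw [← hM]
        exact hPSD (φ X) (fun c hc => h hc) x
end
end

section
/- Central reduction for finitely many constraints: For every finite set S ⊆ Sym TT_n there exists a finite set S' ⊆ Q_S^tr ∩ C_n such that K_S = K_{S'}. -/
noncomputable section

open Matrix

/-- The smallest cyclic quadratic module Q_S^tr containing S. -/
def QtrS (n g : ℕ) (S : Set (MatP n g)) : Set (MatP n g) :=
  {a | ∀ Q : Set (MatP n g), IsCyclicQM n g Q → S ⊆ Q → a ∈ Q}

/-- If finitely many values of a symmetric bilinear form are nonnegative under a real point `φ`,
then so is its Gram form on given vectors. The test vectors, obtained by Schur complements, do not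
depend on `φ`. -/
lemma exists_finite_gram_nonneg {R V : Type*} [CommRing R] [AddCommGroup V] [Module R V]
    (B : LinearMap.BilinForm R V) (hB : ∀ x y, B x y = B y x) (P : Set V)
    (hadd : ∀ u ∈ P, ∀ w ∈ P, u + w ∈ P) (hsub : ∀ u ∈ P, ∀ w ∈ P, u - w ∈ P)
    (hsmul : ∀ u ∈ P, ∀ w ∈ P, ∀ z ∈ P, B u w • z ∈ P) (m : ℕ) (v : Fin m → V)
    (hv : ∀ i, v i ∈ P) :
    ∃ F : Set V, F.Finite ∧ F ⊆ P ∧ ∀ φ : R →+* ℝ, (∀ f ∈ F, 0 ≤ φ (B f f)) →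
      ∀ c : Fin m → ℝ, 0 ≤ ∑ i, ∑ j, c i * c j * φ (B (v i) (v j)) := by
  induction m with
  | zero => exact ⟨∅, Set.finite_empty, Set.empty_subset _, fun _ _ c => by simp⟩
  | succ m ih =>
    have key : ∀ i : Fin (m + 1), _ := fun i =>
      ih (fun k => B (v i) (v i) • v (i.succAbove k) - B (v i) (v (i.succAbove k)) • v i)
        (fun k => hsub _ (hsmul _ (hv _) _ (hv _) _ (hv _)) _ (hsmul _ (hv _) _ (hv _) _ (hv _)))
    choose F hFfin hFP hF using key
    refine ⟨Set.range v ∪ (Set.range (fun ij : Fin (m + 1) × Fin (m + 1) => v ij.1 + v ij.2) ∪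
      (Set.range (fun ij : Fin (m + 1) × Fin (m + 1) => v ij.1 - v ij.2) ∪ ⋃ i, F i)),
      ?_, ?_, ?_⟩
    · exact (Set.finite_range _).union ((Set.finite_range _).union
        ((Set.finite_range _).union (Set.finite_iUnion hFfin)))
    · rintro f (⟨i, rfl⟩ | ⟨ij, rfl⟩ | ⟨ij, rfl⟩ | hf)
      · exact hv i
      · exact hadd _ (hv _) _ (hv _)
      · exact hsub _ (hv _) _ (hv _)
      · obtain ⟨i, hi⟩ := Set.mem_iUnion.1 hf
        exact hFP i hi
    · intro φ h c
      have hdiag : ∀ i, 0 ≤ φ (B (v i) (v i)) := fun i => h _ (Or.inl ⟨i, rfl⟩)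
      by_cases h0 : ∀ i, φ (B (v i) (v i)) = 0
      · refine Finset.sum_nonneg fun i _ => Finset.sum_nonneg fun j _ => ?_
        have h1 := h _ (Or.inr (Or.inl ⟨(i, j), rfl⟩))
        have h2 := h _ (Or.inr (Or.inr (Or.inl ⟨(i, j), rfl⟩)))
        simp only [map_add, map_sub, LinearMap.add_apply, LinearMap.sub_apply, h0,
          hB (v j) (v i)] at h1 h2
        have h3 : φ (B (v i) (v j)) = 0 := by linarith
        simp [h3]
      · push Not at h0
        obtain ⟨i, hi⟩ := h0
        have hpos : 0 < φ (B (v i) (v i)) := lt_of_le_of_ne (hdiag i) (Ne.symm hi)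
        have hN := hF i φ
          (fun f hf => h f (Or.inr (Or.inr (Or.inr (Set.mem_iUnion.2 ⟨i, hf⟩)))))
          (fun k => c (i.succAbove k))
        simp only [map_sub, LinearMap.sub_apply, map_smul, LinearMap.smul_apply, smul_eq_mul,
          map_mul, hB (v (i.succAbove _)) (v i)] at hN
        simp only [Fin.sum_univ_succAbove _ i, hB (v (i.succAbove _)) (v i)]
        set a := φ (B (v i) (v i))
        set β := ∑ k, c (i.succAbove k) * φ (B (v i) (v (i.succAbove k))) with hβ
        set σ := ∑ k, ∑ l, c (i.succAbove k) * c (i.succAbove l) *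
          φ (B (v (i.succAbove k)) (v (i.succAbove l))) with hσ
        have e1 : 0 ≤ a * (a * σ - β * β) := by
          convert hN using 1
          rw [hβ, hσ, Finset.sum_mul_sum]
          simp only [Finset.mul_sum, ← Finset.sum_sub_distrib]
          refine Finset.sum_congr rfl fun k _ => Finset.sum_congr rfl fun l _ => ?_
          ring
        have e2 : 0 ≤ a * σ - β * β := nonneg_of_mul_nonneg_right e1 hpos
        have e3 : ∑ k, c i * c (i.succAbove k) * φ (B (v i) (v (i.succAbove k))) = c i * β := by
          rw [hβ, Finset.mul_sum]
          exact Finset.sum_congr rfl fun k _ => by ring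
        have e4 : ∑ k, c (i.succAbove k) * c i * φ (B (v i) (v (i.succAbove k))) = c i * β := by
          rw [hβ, Finset.mul_sum]
          exact Finset.sum_congr rfl fun k _ => by ring
        rw [Finset.sum_add_distrib, e3, e4, ← hσ]
        refine nonneg_of_mul_nonneg_right ?_ hpos
        nlinarith [sq_nonneg (a * c i + β)]

/-- A real symmetric matrix `A` is positive semidefinite as soon as the Hankel matrix of the
traces of its powers, weighted by `A`, is. -/
lemma posSemidef_of_trace_pow_nonneg {n : ℕ} {A : Matrix (Fin n) (Fin n) ℝ}
    (hA : A.IsHermitian)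
    (h : ∀ c : Fin (n + 1) → ℝ, 0 ≤ ∑ i, ∑ j, c i * c j *
      trace (A ^ (i : ℕ) * A * (A ^ (j : ℕ))ᵀ)) : A.PosSemidef := by
  rw [hA.posSemidef_iff_eigenvalues_nonneg]
  intro k
  by_contra hneg
  replace hneg : hA.eigenvalues k < 0 := by simpa using hneg
  have hroot : (minpoly ℝ A).IsRoot (hA.eigenvalues k) := by
    rw [← Matrix.minpoly_toLin', ← Module.End.hasEigenvalue_iff_isRoot,
      Module.End.hasEigenvalue_iff_mem_spectrum, Matrix.spectrum_toLin']
    exact hA.eigenvalues_mem_spectrum_real k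
  set μ := hA.eigenvalues k
  obtain ⟨p, hp⟩ := Polynomial.dvd_iff_isRoot.2 hroot
  have hint : IsIntegral ℝ A := Matrix.isIntegral A
  have hq0 : minpoly ℝ A ≠ 0 := minpoly.ne_zero hint
  have hp0 : p ≠ 0 := by rintro rfl; exact hq0 (by simpa using hp)
  have hdeg : (minpoly ℝ A).natDegree = 1 + p.natDegree := by
    rw [hp, Polynomial.natDegree_mul (Polynomial.X_sub_C_ne_zero _) hp0,
      Polynomial.natDegree_X_sub_C]
  have hpn : p.natDegree < n + 1 := by
    have := Polynomial.natDegree_le_of_dvd (Matrix.minpoly_dvd_charpoly A)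
      (Matrix.charpoly_monic A).ne_zero
    rw [Matrix.charpoly_natDegree_eq_dim, Fintype.card_fin] at this
    omega
  set M := Polynomial.aeval A p with hM
  have hM0 : M ≠ 0 := fun h0 => by
    have := Polynomial.natDegree_le_of_dvd (minpoly.dvd ℝ A h0) hp0
    omega
  have hAM : A * M = μ • M := by
    have h1 := minpoly.aeval ℝ A
    rw [hp, map_mul, map_sub, Polynomial.aeval_X, Polynomial.aeval_C, sub_mul, sub_eq_zero] at h1
    rw [h1, Algebra.smul_def]
  have hMsum : M = ∑ i : Fin (n + 1), p.coeff i • A ^ (i : ℕ) := by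
    rw [hM, Polynomial.aeval_eq_sum_range' hpn, Finset.sum_range]
  have hcomm : M * A = A * M := by
    rw [hMsum, Finset.sum_mul, Finset.mul_sum]
    refine Finset.sum_congr rfl fun i _ => ?_
    rw [smul_mul_assoc, mul_smul_comm, ← pow_succ, ← pow_succ']
  have hc := h fun i => p.coeff i
  have hsum : ∑ i : Fin (n + 1), ∑ j : Fin (n + 1), p.coeff i * p.coeff j *
      trace (A ^ (i : ℕ) * A * (A ^ (j : ℕ))ᵀ) = trace (M * A * Mᵀ) := by
    conv_rhs => rw [hMsum]
    simp only [Matrix.transpose_sum, Matrix.transpose_smul, Finset.sum_mul, Finset.mul_sum,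
      Matrix.trace_sum, smul_mul_assoc, mul_smul_comm, Matrix.trace_smul, smul_eq_mul]
    rw [Finset.sum_comm]
    refine Finset.sum_congr rfl fun i _ => Finset.sum_congr rfl fun j _ => ?_
    ring
  rw [hsum, hcomm, hAM, smul_mul_assoc, Matrix.trace_smul, smul_eq_mul] at hc
  have hMM : 0 ≤ trace (M * Mᵀ) := by
    simpa using (Matrix.posSemidef_self_mul_conjTranspose M).trace_nonneg
  have hMM0 : trace (M * Mᵀ) ≠ 0 := fun h0 => hM0 (by
    rw [← Matrix.trace_mul_conjTranspose_self_eq_zero_iff]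
    simpa using h0)
  have := lt_of_le_of_ne hMM (Ne.symm hMM0)
  nlinarith

lemma transpose_mem_genSet {n g : ℕ} {x : MatP n g} (hx : x ∈ genSet n g) : xᵀ ∈ genSet n g := by
  rcases hx with ⟨j, rfl⟩ | ⟨j, rfl⟩
  · exact Or.inr ⟨j, rfl⟩
  · exact Or.inl ⟨j, (Matrix.transpose_transpose _).symm⟩

lemma closure_genSet_subset_traceRing {n g : ℕ} {w : MatP n g}
    (hw : w ∈ Submonoid.closure (genSet n g)) : w ∈ traceRing n g :=
  (Submonoid.closure_le (S := (traceRing n g).toSubmonoid)).2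
    (fun _ hx => Algebra.subset_adjoin (Or.inl hx)) hw

lemma transpose_mem_traceRing {n g : ℕ} {h : MatP n g} (hh : h ∈ traceRing n g) :
    hᵀ ∈ traceRing n g := by
  induction hh using Algebra.adjoin_induction with
  | mem x hx =>
    rcases hx with hx | ⟨w, hw, rfl⟩
    · exact Algebra.subset_adjoin (Or.inl (transpose_mem_genSet hx))
    · rw [Matrix.transpose_smul, Matrix.transpose_one]
      exact Algebra.subset_adjoin (Or.inr ⟨w, hw, rfl⟩)
  | algebraMap r =>
    rw [Algebra.algebraMap_eq_smul_one, Matrix.transpose_smul, Matrix.transpose_one]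
    exact (traceRing n g).smul_mem (one_mem _) r
  | add x y _ _ hx hy => rw [Matrix.transpose_add]; exact add_mem hx hy
  | mul x y _ _ hx hy => rw [Matrix.transpose_mul]; exact mul_mem hy hx

lemma trace_smul_one_mem_traceRing {n g : ℕ} {h : MatP n g} (hh : h ∈ traceRing n g) :
    trace h • (1 : MatP n g) ∈ traceRing n g := by
  rw [traceRing, ← Subalgebra.mem_toSubmodule, Algebra.adjoin_eq_span] at hh
  induction hh using Submodule.span_induction with
  | mem x hx =>
    suffices H : ∀ w ∈ Submonoid.closure (genSet n g),
        trace (x * w) • (1 : MatP n g) ∈ traceRing n g by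
      simpa using H 1 (one_mem _)
    induction hx using Submonoid.closure_induction_left with
    | one =>
      intro w hw
      rw [one_mul]
      exact Algebra.subset_adjoin (Or.inr ⟨w, hw, rfl⟩)
    | mul_left x hx y _ ih =>
      intro w hw
      rcases hx with hx | ⟨u, hu, rfl⟩
      · rw [mul_assoc, Matrix.trace_mul_comm, mul_assoc]
        exact ih _ (mul_mem hw (Submonoid.subset_closure hx))
      · have := mul_mem (Algebra.subset_adjoin (Or.inr ⟨u, hu, rfl⟩) :
          trace u • (1 : MatP n g) ∈ traceRing n g) (ih w hw)
        rwa [smul_mul_smul_comm, one_mul, ← smul_eq_mul, ← Matrix.trace_smul,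
          ← smul_mul_assoc, ← smul_one_mul (trace u) y] at this
  | zero => simp
  | add x y _ _ hx hy => rw [Matrix.trace_add, add_smul]; exact add_mem hx hy
  | smul r x _ hx =>
    rw [Matrix.trace_smul, smul_assoc]
    exact (traceRing n g).smul_mem hx r

/-- The bilinear form `(h, k) ↦ tr(h s kᵀ)`. -/
def traceForm (n g : ℕ) (s : MatP n g) : LinearMap.BilinForm (PolyRing n g) (MatP n g) :=
  LinearMap.mk₂ _ (fun h k => trace (h * s * kᵀ))
    (fun x y z => by simp [add_mul])
    (fun c x y => by simp)
    (fun x y z => by simp [mul_add])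
    (fun c x y => by simp)

lemma traceForm_apply (n g : ℕ) (s h k : MatP n g) :
    traceForm n g s h k = trace (h * s * kᵀ) := rfl

/-- Evaluation at `X` as a ring homomorphism. -/
def evalHom (n g : ℕ) (X : Fin g → Matrix (Fin n) (Fin n) ℝ) : PolyRing n g →+* ℝ :=
  MvPolynomial.eval fun v => X v.1 v.2.1 v.2.2

lemma evalHom_traceForm {n g : ℕ} (X : Fin g → Matrix (Fin n) (Fin n) ℝ) (s h k : MatP n g) :
    evalHom n g X (traceForm n g s h k) =
      trace (evalMat n g X h * evalMat n g X s * (evalMat n g X k)ᵀ) := by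
  change _ = trace (h.map (evalHom n g X) * s.map (evalHom n g X) * (k.map (evalHom n g X))ᵀ)
  rw [traceForm_apply, AddMonoidHom.map_trace, ← Matrix.transpose_map, ← Matrix.map_mul,
    ← Matrix.map_mul]

lemma evalMat_pow {n g : ℕ} (X : Fin g → Matrix (Fin n) (Fin n) ℝ) (s : MatP n g) (i : ℕ) :
    evalMat n g X (s ^ i) = evalMat n g X s ^ i :=
  map_pow (evalHom n g X).mapMatrix s i

lemma posSemidef_evalMat_smul_one_iff {n g : ℕ} (hn : 0 < n)
    (X : Fin g → Matrix (Fin n) (Fin n) ℝ) (p : PolyRing n g) :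
    (evalMat n g X (p • 1)).PosSemidef ↔ 0 ≤ evalHom n g X p := by
  have h : evalMat n g X (p • 1) = Matrix.diagonal fun _ => evalHom n g X p := by
    rw [evalMat, ← Matrix.diagonal_one, ← Matrix.diagonal_smul, Matrix.diagonal_map (map_zero _)]
    congr 1
    ext
    simp [evalHom]
  rw [h, Matrix.posSemidef_diagonal_iff]
  exact ⟨fun h => h ⟨0, hn⟩, fun h _ => h⟩

/-- Central reduction for a single constraint. -/
lemma exists_finite_posSemidef_iff {n g : ℕ} {s : MatP n g} (hs : s ∈ traceRing n g)
    (hsT : sᵀ = s) :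
    ∃ F : Set (MatP n g), F.Finite ∧ F ⊆ traceRing n g ∧
      ∀ X, (evalMat n g X s).PosSemidef ↔ ∀ f ∈ F, 0 ≤ evalHom n g X (traceForm n g s f f) := by
  obtain ⟨F, hfin, hsub, hF⟩ := exists_finite_gram_nonneg (traceForm n g s)
    (fun x y => by
      rw [traceForm_apply, traceForm_apply, ← Matrix.trace_transpose]
      simp [Matrix.transpose_mul, hsT, mul_assoc])
    (traceRing n g) (fun _ hu _ hw => add_mem hu hw) (fun _ hu _ hw => sub_mem hu hw)
    (fun u hu w hw z hz => by
      have := mul_mem (trace_smul_one_mem_traceRing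
        (mul_mem (mul_mem hu hs) (transpose_mem_traceRing hw))) hz
      rwa [smul_mul_assoc, one_mul] at this)
    (n + 1) (fun i => s ^ (i : ℕ)) (fun i => pow_mem hs _)
  refine ⟨F, hfin, hsub, fun X => ⟨fun hX f _ => ?_, fun h => ?_⟩⟩
  · rw [evalHom_traceForm]
    exact (hX.mul_mul_conjTranspose_same _).trace_nonneg
  · refine posSemidef_of_trace_pow_nonneg ?_ fun c => ?_
    · rw [Matrix.IsHermitian, Matrix.conjTranspose_eq_transpose_of_trivial]
      conv_rhs => rw [← hsT]
      exact Matrix.transpose_map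
    · simpa only [evalHom_traceForm, evalMat_pow] using hF (evalHom n g X) h c

/-- Central reduction for finitely many constraints. -/
theorem stmt10 (n g : ℕ) (hn : 0 < n) (hg : 0 < g)
    (S : Set (MatP n g)) (hSfin : S.Finite)
    (hS : ∀ s ∈ S, s ∈ traceRing n g ∧ sᵀ = s) :
    ∃ S' : Set (MatP n g),
      S'.Finite ∧ S' ⊆ QtrS n g S ∩ centerSet n g ∧
      KSet n g S = KSet n g S' := by
  choose! F hfin hsub hF using fun s (hs : s ∈ S) =>
    exists_finite_posSemidef_iff (hS s hs).1 (hS s hs).2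
  refine ⟨⋃ s ∈ S, (fun f => traceForm n g s f f • (1 : MatP n g)) '' F s,
    hSfin.biUnion fun s hs => (hfin s hs).image _, ?_, ?_⟩
  · intro c hc
    simp only [Set.mem_iUnion, Set.mem_image] at hc
    obtain ⟨s, hs, f, hf, rfl⟩ := hc
    have hfT := hsub s hs hf
    refine ⟨?_, trace_smul_one_mem_traceRing
      (mul_mem (mul_mem hfT (hS s hs).1) (transpose_mem_traceRing hfT)), _, rfl⟩
    rintro Q ⟨-, -, -, hconj, htr⟩ hSQ
    exact htr _ (hconj f hfT s (hSQ hs))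
  · ext X
    simp only [KSet, Set.mem_ofPred_eq, Set.mem_iUnion, Set.mem_image]
    constructor
    · rintro h _ ⟨s, hs, f, hf, rfl⟩
      exact (posSemidef_evalMat_smul_one_iff hn X _).2 ((hF s hs X).1 (h s hs) f hf)
    · intro h s hs
      exact (hF s hs X).2 fun f hf =>
        (posSemidef_evalMat_smul_one_iff hn X _).1 (h _ ⟨s, hs, f, hf, rfl⟩)
end
end
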